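/- The knot DGA of the unknot, which is the algebra over R = Z[λ^{±1},μ^{±1},U^{±1}] generated by c, d in degree 1 and e, f in degree 2 with differential ∂c = U - λ - μ + λμ, ∂d = 1 - μ - λ^{-1}U + λ^{-1}μ, ∂e = -c - λd, ∂f = -d - λ^{-1}c, is stable tame isomorphic to the DGA over R generated by c in degree 1 and e in degree 2 with differential ∂c = U - λ - μ + λμ and ∂e = 0. -/

import Mathlib

/-- A (free, finitely generated) differential graded algebra over `R`: the free
noncommutative unital algebra on generators `a_1, …, a_n` of degrees `deg i`,
together with a grading and a degree `-1` differential satisfying the signed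
Leibniz rule and `∂² = 0`. -/
structure DGAData (R : Type) [CommRing R] (n : ℕ) where
  deg : Fin n → ℤ
  grading : ℤ → Submodule R (FreeAlgebra R (Fin n))
  graded : GradedAlgebra grading
  mem_gen : ∀ i : Fin n, FreeAlgebra.ι R i ∈ grading (deg i)
  d : FreeAlgebra R (Fin n) →ₗ[R] FreeAlgebra R (Fin n)
  d_mem : ∀ (i : ℤ) (x : FreeAlgebra R (Fin n)), x ∈ grading i → d x ∈ grading (i - 1)
  leibniz : ∀ (i : ℤ) (x y : FreeAlgebra R (Fin n)), x ∈ grading i →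
    d (x * y) = d x * y + ((Int.negOnePow i : ℤˣ) : ℤ) • (x * d y)
  d_sq : ∀ x, d (d x) = 0

variable {R : Type} [CommRing R]

/-- An elementary automorphism of the free algebra: it fixes all generators except
one, `a_i`, which is sent to `a_i + v` where `v` lies in the subalgebra generated by
the other generators. -/
def IsElementary {n : ℕ} (φ : FreeAlgebra R (Fin n) ≃ₐ[R] FreeAlgebra R (Fin n)) : Prop :=
  ∃ i : Fin n, (∀ j : Fin n, j ≠ i → φ (FreeAlgebra.ι R j) = FreeAlgebra.ι R j) ∧
    ∃ v ∈ Algebra.adjoin R (FreeAlgebra.ι R '' {j : Fin n | j ≠ i}),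
      φ (FreeAlgebra.ι R i) = FreeAlgebra.ι R i + v

/-- A tame automorphism is a composition of elementary automorphisms. -/
def IsTame {n : ℕ} (φ : FreeAlgebra R (Fin n) ≃ₐ[R] FreeAlgebra R (Fin n)) : Prop :=
  φ ∈ Subgroup.closure {ψ | IsElementary ψ}

/-- A tame isomorphism between two DGAs with the same number of generators:
a tame automorphism followed by a degree-preserving renaming of the generators,
intertwining the differentials. -/
def TameIso {n : ℕ} (G H : DGAData R n) : Prop :=
  ∃ (e : Fin n ≃ Fin n) (φ₁ : FreeAlgebra R (Fin n) ≃ₐ[R] FreeAlgebra R (Fin n)),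
    IsTame φ₁ ∧ (∀ i, H.deg (e i) = G.deg i) ∧
    (∀ x, (FreeAlgebra.lift R (fun i => FreeAlgebra.ι R (e i))) (φ₁ (G.d x)) =
      H.d ((FreeAlgebra.lift R (fun i => FreeAlgebra.ι R (e i))) (φ₁ x)))

/-- `H` is a stabilization of `G`: it is obtained by adjoining two new free
generators `e₁, e₂` with `|e₁| = |e₂| + 1`, `∂e₁ = e₂`, `∂e₂ = 0`, the grading and
differential otherwise extending those of `G`. -/
def IsStab {n : ℕ} (G : DGAData R n) (H : DGAData R (n + 2)) : Prop :=
  letI j : FreeAlgebra R (Fin n) →ₐ[R] FreeAlgebra R (Fin (n + 2)) :=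
    FreeAlgebra.lift R (fun i => FreeAlgebra.ι R (Fin.castAdd 2 i))
  (∀ i : Fin n, H.deg (Fin.castAdd 2 i) = G.deg i) ∧
  H.deg ⟨n, by omega⟩ = H.deg ⟨n + 1, by omega⟩ + 1 ∧
  (∀ x, H.d (j x) = j (G.d x)) ∧
  (∀ (i : ℤ) (x : FreeAlgebra R (Fin n)), x ∈ G.grading i → j x ∈ H.grading i) ∧
  H.d (FreeAlgebra.ι R (⟨n, by omega⟩ : Fin (n + 2))) =
    FreeAlgebra.ι R (⟨n + 1, by omega⟩ : Fin (n + 2)) ∧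
  H.d (FreeAlgebra.ι R (⟨n + 1, by omega⟩ : Fin (n + 2))) = 0

/-- The stabilization relation on DGAs (of varying numbers of generators). -/
def StabRel (P Q : Σ k : ℕ, DGAData R k) : Prop :=
  ∃ h : Q.1 = P.1 + 2, IsStab P.2 (h ▸ Q.2)

/-- Two DGAs are stable tame isomorphic if, after stabilizing each of them some
(possibly different) number of times, they become tamely isomorphic. -/
def StableTameIso {n m : ℕ} (G : DGAData R n) (H : DGAData R m) : Prop :=
  ∃ P Q : Σ k : ℕ, DGAData R k,
    Relation.ReflTransGen StabRel (⟨n, G⟩ : Σ k, DGAData R k) P ∧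
    Relation.ReflTransGen StabRel (⟨m, H⟩ : Σ k, DGAData R k) Q ∧
    ∃ h : P.1 = Q.1, TameIso (h ▸ P.2) Q.2

/-- The ring `R = ℤ[λ^{±1}, μ^{±1}, U^{±1}]` as the group algebra `ℤ[ℤ³]`. -/
abbrev KCHRing : Type := AddMonoidAlgebra ℤ (ℤ × ℤ × ℤ)

noncomputable def lamR : KCHRing := AddMonoidAlgebra.single (1, 0, 0) 1
noncomputable def lamInvR : KCHRing := AddMonoidAlgebra.single (-1, 0, 0) 1
noncomputable def muR : KCHRing := AddMonoidAlgebra.single (0, 1, 0) 1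
noncomputable def UR : KCHRing := AddMonoidAlgebra.single (0, 0, 1) 1

open FreeAlgebra in
/-- The algebra endomorphism sending `a_i` to `a_i + r a_k` and fixing the other generators. -/
noncomputable def elemHom {n : ℕ} (i k : Fin n) (r : R) :
    FreeAlgebra R (Fin n) →ₐ[R] FreeAlgebra R (Fin n) :=
  FreeAlgebra.lift R (fun j => if j = i then ι R i + r • ι R k else ι R j)

theorem elemHom_comp {n : ℕ} (i k : Fin n) (hk : k ≠ i) (r s : R) (hrs : r + s = 0) :
    (elemHom i k r).comp (elemHom i k s) = AlgHom.id R (FreeAlgebra R (Fin n)) := by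
  apply FreeAlgebra.hom_ext
  funext j
  by_cases hj : j = i
  · subst hj
    simp [elemHom, hk, add_assoc, ← add_smul, hrs]
  · simp [elemHom, hj]

/-- The elementary automorphism `a_i ↦ a_i + r a_k`. -/
noncomputable def elemEquiv {n : ℕ} (i k : Fin n) (hk : k ≠ i) (r : R) :
    FreeAlgebra R (Fin n) ≃ₐ[R] FreeAlgebra R (Fin n) :=
  AlgEquiv.ofAlgHom (elemHom i k r) (elemHom i k (-r))
    (elemHom_comp i k hk _ _ (by simp)) (elemHom_comp i k hk _ _ (by simp))

theorem elemEquiv_ι {n : ℕ} (i k : Fin n) (hk : k ≠ i) (r : R) (j : Fin n) :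
    elemEquiv i k hk r (FreeAlgebra.ι R j) =
      if j = i then FreeAlgebra.ι R i + r • FreeAlgebra.ι R k else FreeAlgebra.ι R j := by
  simp [elemEquiv, elemHom]

theorem elemEquiv_isElementary {n : ℕ} (i k : Fin n) (hk : k ≠ i) (r : R) :
    IsElementary (elemEquiv i k hk r) := by
  refine ⟨i, fun j hj => by simp [elemEquiv_ι, hj], r • FreeAlgebra.ι R k, ?_, ?_⟩
  · exact Subalgebra.smul_mem _ (Algebra.subset_adjoin (Set.mem_image_of_mem _ hk)) r
  · simp [elemEquiv_ι]

/-- The renaming isomorphism attached to a permutation of the generators. -/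
noncomputable def renameEquiv {n : ℕ} (e : Fin n ≃ Fin n) :
    FreeAlgebra R (Fin n) ≃ₐ[R] FreeAlgebra R (Fin n) :=
  AlgEquiv.ofAlgHom (FreeAlgebra.lift R (fun i => FreeAlgebra.ι R (e i)))
    (FreeAlgebra.lift R (fun i => FreeAlgebra.ι R (e.symm i)))
    (by apply FreeAlgebra.hom_ext; funext j; simp)
    (by apply FreeAlgebra.hom_ext; funext j; simp)

/-- Transport of a DGA along an automorphism `T` of the free algebra
(the new differential is `T⁻¹ ∂ T`). -/
noncomputable def DGAData.transport {n : ℕ} (G : DGAData R n)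
    (T : FreeAlgebra R (Fin n) ≃ₐ[R] FreeAlgebra R (Fin n)) (deg : Fin n → ℤ)
    (hdeg : ∀ i, T (FreeAlgebra.ι R i) ∈ G.grading (deg i)) : DGAData R n where
  deg := deg
  grading := fun i => (G.grading i).comap T.toLinearMap
  graded := by
    letI := G.graded
    have hint : DirectSum.IsInternal (fun i => (G.grading i).comap T.toLinearMap) := by
      have h0 := (DirectSum.isInternal_submodule_iff_iSupIndep_and_iSup_eq_top _).1
        (DirectSum.Decomposition.isInternal G.grading)
      have hc : (fun i => (G.grading i).comap T.toLinearMap) =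
          (Submodule.orderIsoMapComap T.toLinearEquiv).symm ∘ G.grading := by
        funext i
        rfl
      rw [DirectSum.isInternal_submodule_iff_iSupIndep_and_iSup_eq_top, hc]
      refine ⟨h0.1.map_orderIso _, ?_⟩
      have := (Submodule.orderIsoMapComap T.toLinearEquiv).symm.map_iSup G.grading
      rw [h0.2] at this
      rw [← sSup_range, Set.range_comp]
      rw [sSup_image, iSup_range]
      rw [← this]
      exact OrderIso.map_top _
    letI : DirectSum.Decomposition (fun i => (G.grading i).comap T.toLinearMap) :=
      hint.chooseDecomposition
    exact
      { one_mem := by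
          simpa using SetLike.GradedOne.one_mem (A := G.grading)
        mul_mem := fun i j x y hx hy => by
          simpa using SetLike.GradedMul.mul_mem (A := G.grading) hx hy }
  mem_gen := fun i => by simpa using hdeg i
  d := T.symm.toLinearMap ∘ₗ G.d ∘ₗ T.toLinearMap
  d_mem := fun i x hx => by
    simpa using G.d_mem i (T x) (by simpa using hx)
  leibniz := fun i x y hx => by
    have := G.leibniz i (T x) (T y) (by simpa using hx)
    simp [this]
  d_sq := fun x => by simp [G.d_sq]

theorem DGAData.d_one {n : ℕ} (G : DGAData R n) : G.d 1 = 0 := by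
  letI := G.graded
  have := G.leibniz 0 1 1 (SetLike.GradedOne.one_mem (A := G.grading))
  simpa using this

/-- An algebra map sending generators to elements of the right degree preserves degrees. -/
theorem DGAData.map_grading {n m : ℕ} (H : DGAData R n) (S : DGAData R m)
    (j : FreeAlgebra R (Fin n) →ₐ[R] FreeAlgebra R (Fin m))
    (hj : ∀ i, j (FreeAlgebra.ι R i) ∈ S.grading (H.deg i))
    (i : ℤ) (x : FreeAlgebra R (Fin n)) (hx : x ∈ H.grading i) : j x ∈ S.grading i := by
  letI := H.graded
  letI := S.graded
  let K : ℤ → Submodule R (FreeAlgebra R (Fin n)) :=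
    fun i => H.grading i ⊓ (S.grading i).comap j.toLinearMap
  haveI : SetLike.GradedMonoid K :=
    { one_mem := ⟨SetLike.GradedOne.one_mem (A := H.grading), by
          simpa using SetLike.GradedOne.one_mem (A := S.grading)⟩
      mul_mem := fun i k x y hx hy => ⟨SetLike.GradedMul.mul_mem (A := H.grading) hx.1 hy.1, by
          simpa using SetLike.GradedMul.mul_mem (A := S.grading) hx.2 hy.2⟩ }
  have htop : ∀ y, y ∈ ⨆ i, K i := by
    intro y
    rw [Submodule.iSup_eq_toSubmodule_range K]
    change y ∈ (DirectSum.coeAlgHom K).range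
    induction y using FreeAlgebra.induction with
    | grade0 r => exact Subalgebra.algebraMap_mem _ r
    | grade1 k =>
      have hk : FreeAlgebra.ι R k ∈ K (H.deg k) := ⟨H.mem_gen k, hj k⟩
      have h2 := Submodule.mem_iSup_of_mem (p := K) (H.deg k) hk
      rw [Submodule.iSup_eq_toSubmodule_range K] at h2
      exact h2
    | mul a b ha hb => exact Subalgebra.mul_mem _ ha hb
    | add a b ha hb => exact Subalgebra.add_mem _ ha hb
  have hproj : ∀ y, ∀ i, ((DirectSum.decompose H.grading y i : H.grading i) :
      FreeAlgebra R (Fin n)) ∈ K i := by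
    intro y
    refine Submodule.iSup_induction K (motive := fun y => ∀ i,
      ((DirectSum.decompose H.grading y i : H.grading i) :
        FreeAlgebra R (Fin n)) ∈ K i) (htop y) ?_ ?_ ?_
    · intro k z hz i
      by_cases hik : k = i
      · subst hik
        rw [DirectSum.decompose_of_mem_same _ hz.1]
        exact hz
      · rw [DirectSum.decompose_of_mem_ne _ hz.1 hik]
        exact Submodule.zero_mem _
    · intro i
      simp
    · intro a b ha hb i
      rw [DirectSum.decompose_add]
      exact Submodule.add_mem _ (ha i) (hb i)
  have := hproj x i
  rw [DirectSum.decompose_of_mem_same _ hx] at this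
  exact this.2

/-- Compatibility with the differentials can be checked on generators. -/
theorem DGAData.map_d {n m : ℕ} (H : DGAData R n) (S : DGAData R m)
    (j : FreeAlgebra R (Fin n) →ₐ[R] FreeAlgebra R (Fin m))
    (hj : ∀ i, j (FreeAlgebra.ι R i) ∈ S.grading (H.deg i))
    (hd : ∀ i, S.d (j (FreeAlgebra.ι R i)) = j (H.d (FreeAlgebra.ι R i)))
    (x : FreeAlgebra R (Fin n)) : S.d (j x) = j (H.d x) := by
  have key : ∀ y, S.d (j y) = j (H.d y) → S.d (j (x * y)) = j (H.d (x * y)) := by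
    induction x using FreeAlgebra.induction with
    | grade0 r =>
      intro y hy
      rw [← Algebra.smul_def, map_smul, map_smul, map_smul, map_smul, hy]
    | grade1 k =>
      intro y hy
      rw [map_mul, S.leibniz _ _ _ (hj k), H.leibniz _ _ _ (H.mem_gen k), hy, hd k,
        map_add, map_zsmul, map_mul, map_mul]
    | mul a b ha hb =>
      intro y hy
      rw [mul_assoc]
      exact ha _ (hb y hy)
    | add a b ha hb =>
      intro y hy
      rw [add_mul, map_add, map_add, map_add, map_add, ha y hy, hb y hy]
  simpa using key 1 (by simp [DGAData.d_one])

theorem lin_one {M : Type*} [AddCommGroup M] [Module R M] (l m : R) (h : l * m = 1) (c d : M) :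
    -c - l • d + (-l) • (-d - m • c) = 0 := by
  rw [smul_sub, smul_smul, neg_mul, h]
  module

theorem lin_two {M : Type*} [AddCommGroup M] [Module R M] (l m : R) (h : l * m = 1) (c d : M) :
    -c - l • d + (-(1 + l)) • (-d - m • c) = d + m • c := by
  rw [smul_sub, smul_smul, neg_mul, add_mul, h]
  module

theorem lam_mul_lamInv : lamR * lamInvR = 1 := by
  simp [lamR, lamInvR, AddMonoidAlgebra.single_mul_single, AddMonoidAlgebra.one_def]
  rfl

/-- The tame change of variables: `d ↦ d + λ⁻¹ c`, `e ↦ e - (1 + λ) f`, `f ↦ e - λ f`. -/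
noncomputable def chi : FreeAlgebra KCHRing (Fin 4) ≃ₐ[KCHRing] FreeAlgebra KCHRing (Fin 4) :=
  elemEquiv 1 0 (by decide) lamInvR * (elemEquiv 2 3 (by decide) (-(1 + lamR)) *
    elemEquiv 3 2 (by decide) 1)

theorem chi_tame : IsTame chi :=
  Subgroup.mul_mem _ (Subgroup.subset_closure (elemEquiv_isElementary _ _ _ _))
    (Subgroup.mul_mem _ (Subgroup.subset_closure (elemEquiv_isElementary _ _ _ _))
      (Subgroup.subset_closure (elemEquiv_isElementary _ _ _ _)))

theorem chi_zero : chi (FreeAlgebra.ι KCHRing 0) = FreeAlgebra.ι KCHRing 0 := by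
  simp [chi, elemEquiv_ι]

theorem chi_one : chi (FreeAlgebra.ι KCHRing 1) =
    FreeAlgebra.ι KCHRing 1 + lamInvR • FreeAlgebra.ι KCHRing 0 := by
  simp [chi, elemEquiv_ι]

theorem chi_two : chi (FreeAlgebra.ι KCHRing 2) =
    FreeAlgebra.ι KCHRing 2 + (-(1 + lamR)) • FreeAlgebra.ι KCHRing 3 := by
  simp only [chi, AlgEquiv.mul_apply, elemEquiv_ι, map_add, map_smul]
  simp [elemEquiv_ι]

theorem chi_three : chi (FreeAlgebra.ι KCHRing 3) =
    FreeAlgebra.ι KCHRing 2 + (-lamR) • FreeAlgebra.ι KCHRing 3 := by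
  simp only [chi, AlgEquiv.mul_apply, elemEquiv_ι, map_add, map_smul]
  simp [elemEquiv_ι]
  module

/-- The knot DGA of the unknot — generated over `R = ℤ[λ^{±1},μ^{±1},U^{±1}]` by
`c, d` in degree `1` and `e, f` in degree `2` with `∂c = U - λ - μ + λμ`,
`∂d = 1 - μ - λ⁻¹U + λ⁻¹μ`, `∂e = -c - λd`, `∂f = -d - λ⁻¹c` — is stable tame
isomorphic to the DGA generated by `c` (degree `1`) and `e` (degree `2`) with
`∂c = U - λ - μ + λμ`, `∂e = 0`. -/
theorem unknot_DGA_stable_tame_iso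
    (G : DGAData KCHRing 4) (H : DGAData KCHRing 2)
    (hGdeg : G.deg = ![1, 1, 2, 2]) (hHdeg : H.deg = ![1, 2])
    (hGc : G.d (FreeAlgebra.ι KCHRing (0 : Fin 4)) =
      algebraMap KCHRing _ (UR - lamR - muR + lamR * muR))
    (hGd : G.d (FreeAlgebra.ι KCHRing (1 : Fin 4)) =
      algebraMap KCHRing _ (1 - muR - lamInvR * UR + lamInvR * muR))
    (hGe : G.d (FreeAlgebra.ι KCHRing (2 : Fin 4)) =
      -(FreeAlgebra.ι KCHRing (0 : Fin 4))
        - algebraMap KCHRing _ lamR * FreeAlgebra.ι KCHRing (1 : Fin 4))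
    (hGf : G.d (FreeAlgebra.ι KCHRing (3 : Fin 4)) =
      -(FreeAlgebra.ι KCHRing (1 : Fin 4))
        - algebraMap KCHRing _ lamInvR * FreeAlgebra.ι KCHRing (0 : Fin 4))
    (hHc : H.d (FreeAlgebra.ι KCHRing (0 : Fin 2)) =
      algebraMap KCHRing _ (UR - lamR - muR + lamR * muR))
    (hHe : H.d (FreeAlgebra.ι KCHRing (1 : Fin 2)) = 0) :
    StableTameIso G H := by
  let e : Fin 4 ≃ Fin 4 := Equiv.swap 1 3
  let T : FreeAlgebra KCHRing (Fin 4) ≃ₐ[KCHRing] FreeAlgebra KCHRing (Fin 4) :=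
    (renameEquiv e).symm.trans chi
  have hT : ∀ i, T (FreeAlgebra.ι KCHRing i) = chi (FreeAlgebra.ι KCHRing (e i)) := by
    intro i
    simp [T, renameEquiv, e]
  have e0 : e 0 = 0 := by decide
  have e1 : e 1 = 3 := by decide
  have e2 : e 2 = 2 := by decide
  have e3 : e 3 = 1 := by decide
  have hT0 := hT 0
  have hT1 := hT 1
  have hT2 := hT 2
  have hT3 := hT 3
  rw [e0, chi_zero] at hT0
  rw [e1, chi_three] at hT1
  rw [e2, chi_two] at hT2
  rw [e3, chi_one] at hT3
  have m0 := G.mem_gen 0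
  have m1 := G.mem_gen 1
  have m2 := G.mem_gen 2
  have m3 := G.mem_gen 3
  simp [hGdeg] at m0 m1 m2 m3
  have hdeg : ∀ i, T (FreeAlgebra.ι KCHRing i) ∈ G.grading ((![1, 2, 2, 1] : Fin 4 → ℤ) i) := by
    intro i
    fin_cases i
    · change T (FreeAlgebra.ι KCHRing 0) ∈ G.grading 1
      rw [hT0]; exact m0
    · change T (FreeAlgebra.ι KCHRing 1) ∈ G.grading 2
      rw [hT1]; exact Submodule.add_mem _ m2 (Submodule.smul_mem _ _ m3)
    · change T (FreeAlgebra.ι KCHRing 2) ∈ G.grading 2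
      rw [hT2]; exact Submodule.add_mem _ m2 (Submodule.smul_mem _ _ m3)
    · change T (FreeAlgebra.ι KCHRing 3) ∈ G.grading 1
      rw [hT3]; exact Submodule.add_mem _ m1 (Submodule.smul_mem _ _ m0)
  let S := G.transport T _ hdeg
  have hSd : ∀ x, S.d x = T.symm (G.d (T x)) := fun x => rfl
  have hinv := lam_mul_lamInv
  rw [← Algebra.smul_def] at hGe hGf
  have s0 : S.d (FreeAlgebra.ι KCHRing 0) =
      algebraMap KCHRing _ (UR - lamR - muR + lamR * muR) := by
    rw [hSd, hT0, hGc, AlgEquiv.commutes]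
  have s1 : S.d (FreeAlgebra.ι KCHRing 1) = 0 := by
    rw [hSd, hT1, map_add, map_smul, hGe, hGf, lin_one _ _ hinv, map_zero]
  have s2 : S.d (FreeAlgebra.ι KCHRing 2) = FreeAlgebra.ι KCHRing 3 := by
    rw [hSd, AlgEquiv.symm_apply_eq, hT2, hT3, map_add, map_smul, hGe, hGf]
    exact lin_two _ _ hinv _ _
  have s3 : S.d (FreeAlgebra.ι KCHRing 3) = 0 := by
    rw [← s2]; exact S.d_sq _
  refine ⟨⟨4, G⟩, ⟨4, S⟩, Relation.ReflTransGen.refl, Relation.ReflTransGen.single ⟨rfl, ?_⟩,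
    rfl, e, chi⁻¹, Subgroup.inv_mem _ chi_tame, ?_, ?_⟩
  · change IsStab H S
    have hj : ∀ i, (FreeAlgebra.lift KCHRing (fun i : Fin 2 =>
        FreeAlgebra.ι KCHRing (Fin.castAdd 2 i))) (FreeAlgebra.ι KCHRing i) ∈
          S.grading (H.deg i) := by
      intro i
      rw [FreeAlgebra.lift_ι_apply, hHdeg]
      fin_cases i
      · exact S.mem_gen 0
      · exact S.mem_gen 1
    refine ⟨?_, ?_, ?_, ?_, s2, s3⟩
    · intro i
      rw [hHdeg]
      fin_cases i <;> rfl
    · rfl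
    · refine H.map_d S _ hj ?_
      intro i
      rw [FreeAlgebra.lift_ι_apply]
      fin_cases i
      · exact s0.trans (by simp only [Fin.zero_eta, hHc, AlgHom.commutes])
      · exact s1.trans (by simp only [Fin.mk_one, hHe, map_zero])
    · exact H.map_grading S _ hj
  · intro i
    change (![1, 2, 2, 1] : Fin 4 → ℤ) (e i) = G.deg i
    rw [hGdeg]
    fin_cases i <;> rfl
  · intro x
    change renameEquiv e (chi.symm (G.d x)) =
      renameEquiv e (chi.symm (G.d (chi ((renameEquiv e).symm (renameEquiv e (chi.symm x))))))
    simp
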